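/- Every nonnegative integer n can be written as n = p₅(x₁) + p₅(x₂) + 2·p₅(x₃) + 4·p₅(x₄) with x₁, x₂, x₃, x₄ nonnegative integers. -/

import Mathlib

/-- Reduction of positive definite binary forms: a small properly represented value. -/
lemma binary_reduce (N : ℕ) : ∀ m k l D : ℤ, m ≤ N → 0 < m → 0 < D → m * l - k ^ 2 = D →
    ∃ p r u v : ℤ, u * p + v * r = 1 ∧ 0 < m * p ^ 2 + 2 * k * p * r + l * r ^ 2 ∧
      3 * (m * p ^ 2 + 2 * k * p * r + l * r ^ 2) ^ 2 ≤ 4 * D := by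
  induction N with
  | zero => intro m k l D h1 h2; simp at h1; omega
  | succ N ih =>
    intro m k l D hm hm0 hD h
    obtain ⟨t, ht1, ht2⟩ : ∃ t : ℤ, -m ≤ 2 * (k + t * m) ∧ 2 * (k + t * m) ≤ m := by
      refine ⟨-((2 * k + m) / (2 * m)), ?_, ?_⟩
      · have := Int.mul_ediv_self_le (x := 2 * k + m) (k := 2 * m) (by omega)
        nlinarith
      · have := Int.lt_mul_ediv_self_add (x := 2 * k + m) (k := 2 * m) (by omega)
        nlinarith
    set k' := k + t * m with hk'
    set l' := m * t ^ 2 + 2 * k * t + l with hl'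
    have h' : m * l' - k' ^ 2 = D := by rw [hl', hk', ← h]; ring
    have hk2 : 4 * k' ^ 2 ≤ m ^ 2 := by nlinarith
    by_cases hc : m ≤ l'
    · refine ⟨1, 0, 1, 0, by ring, by simpa using hm0, ?_⟩
      ring_nf
      nlinarith
    · have hl0 : 0 < l' := by
        by_contra hneg
        have : m * l' ≤ 0 := mul_nonpos_of_nonneg_of_nonpos hm0.le (by omega)
        nlinarith [sq_nonneg k']
      obtain ⟨p, r, u, v, h1, h2, h3⟩ := ih l' (-k') m D (by push_cast at hm; omega) hl0 hD
        (by rw [← h']; ring)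
      have e : m * (t * p - r) ^ 2 + 2 * k * (t * p - r) * p + l * p ^ 2 =
          l' * p ^ 2 + 2 * (-k') * p * r + m * r ^ 2 := by rw [hl', hk']; ring
      refine ⟨t * p - r, p, -v, u + v * t, by rw [← h1]; ring, ?_, ?_⟩
      · rw [e]; exact h2
      · rw [e]; exact h3

lemma descent_aux (a a' f' M : ℤ) (h4 : 2 ≤ a) (hneg : a ≤ a') (ht1 : -a ≤ 2 * f')
    (ht2 : 2 * f' ≤ a) (haa : a * a' = f' ^ 2 + M) (hg : 3 * M ^ 2 ≤ 4 * a) : False := by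
  have h1 : a * a ≤ a * a' := mul_le_mul_of_nonneg_left hneg (by omega)
  have h2 : 4 * f' ^ 2 ≤ a ^ 2 := by nlinarith only [ht1, ht2]
  have h3 : 3 * a ^ 2 ≤ 4 * M := by nlinarith only [h1, h2, haa]
  have h5 : 6 * a ≤ 4 * M := by nlinarith only [h3, h4]
  nlinarith only [h5, h4, hg]

/-- Positive definite integral ternary forms of determinant one only represent sums
of three squares. -/
lemma ternary (N : ℕ) : ∀ a b c d e f : ℤ, a ≤ N → 0 < a → 0 < a * b - f ^ 2 →
    a * b * c + 2 * d * e * f - a * d ^ 2 - b * e ^ 2 - c * f ^ 2 = 1 → ∀ x y z : ℤ,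
    ∃ u v w : ℤ, a * x ^ 2 + b * y ^ 2 + c * z ^ 2 + 2 * d * y * z + 2 * e * x * z
      + 2 * f * x * y = u ^ 2 + v ^ 2 + w ^ 2 := by
  induction N with
  | zero => intro a b c d e f h1 h2; simp at h1; omega
  | succ N ih =>
    intro a b c d e f ha ha0 hm hdet x y z
    obtain ⟨p, r, s, q', hs, hg0, hg⟩ := binary_reduce (a * b - f ^ 2).toNat (a * b - f ^ 2)
      (a * d - e * f) (a * c - e ^ 2) a (by omega) hm ha0
      (by linear_combination a * hdet)
    obtain ⟨q, rfl⟩ : ∃ q, q' = -q := ⟨-q', by ring⟩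
    set M := (a * b - f ^ 2) * p ^ 2 + 2 * (a * d - e * f) * p * r + (a * c - e ^ 2) * r ^ 2
      with hM
    set x' := s * y - q * z with hx'
    set z' := -r * y + p * z with hz'
    have hy : y = p * x' + q * z' := by
      rw [hx', hz']; linear_combination (-y) * hs
    have hz : z = r * x' + s * z' := by
      rw [hx', hz']; linear_combination (-z) * hs
    clear_value x' z'
    subst hy hz
    by_cases ha1 : a = 1
    · subst ha1
      have hM1 : M = 1 := by nlinarith
      set d' := b * p * q + c * r * s + d * (p * s + q * r)
        - (f * p + e * r) * (f * q + e * s) with hd'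
      have hcc : b * q ^ 2 + c * s ^ 2 + 2 * d * q * s - (f * q + e * s) ^ 2 = 1 + d' ^ 2 := by
        have : M * (b * q ^ 2 + c * s ^ 2 + 2 * d * q * s - (f * q + e * s) ^ 2) - d' ^ 2 = 1 := by
          have h2 : (s * p + -q * r) ^ 2 = 1 := by rw [hs]; norm_num
          rw [hM, hd']
          linear_combination (s * p + -q * r) ^ 2 * hdet + h2
        rw [hM1] at this
        linarith
      refine ⟨x + f * (p * x' + q * z') + e * (r * x' + s * z'), x' + d' * z', z', ?_⟩
      linear_combination (x' ^ 2) * hM1 - x' ^ 2 * hM + z' ^ 2 * hcc - 2 * x' * z' * hd'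
    · obtain ⟨t, ht1, ht2⟩ : ∃ t : ℤ, -a ≤ 2 * (f * p + e * r + t * a) ∧
          2 * (f * p + e * r + t * a) ≤ a := by
        set k := f * p + e * r
        refine ⟨-((2 * k + a) / (2 * a)), ?_, ?_⟩
        · have := Int.mul_ediv_self_le (x := 2 * k + a) (k := 2 * a) (by omega)
          nlinarith
        · have := Int.lt_mul_ediv_self_add (x := 2 * k + a) (k := 2 * a) (by omega)
          nlinarith
      set f' := f * p + e * r + t * a with hf'
      set a' := a * t ^ 2 + b * p ^ 2 + c * r ^ 2 + 2 * d * p * r + 2 * e * t * r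
        + 2 * f * t * p with ha'
      have haa : a * a' = f' ^ 2 + M := by rw [ha', hf', hM]; ring
      have ha'0 : 0 < a' := by
        by_contra hneg
        have : a * a' ≤ 0 := mul_nonpos_of_nonneg_of_nonpos ha0.le (by omega)
        nlinarith [sq_nonneg f']
      have hlt : a' < a := by
        by_contra hneg
        exact descent_aux a a' f' M (by omega) (by omega) ht1 ht2 haa hg
      obtain ⟨u, v, w, h⟩ := ih a' a (b * q ^ 2 + c * s ^ 2 + 2 * d * q * s)
        (f * q + e * s)
        (f * t * q + e * t * s + b * p * q + c * r * s + d * (p * s + r * q)) f'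
        (by push_cast at ha; omega) ha'0 (by linarith)
        (by
          have h2 : (s * p + -q * r) ^ 2 = 1 := by rw [hs]; norm_num
          rw [ha', hf']
          linear_combination (s * p + -q * r) ^ 2 * hdet + h2) x' (x - t * x') z'
      refine ⟨u, v, w, ?_⟩
      rw [← h, ha', hf']
      ring

lemma three_squares (n : ℕ) (hn : n % 4 = 2) : ∃ u v w : ℤ, (n : ℤ) = u ^ 2 + v ^ 2 + w ^ 2 := by
  have hcop : (n - 1).Coprime (4 * n) := by
    have h1 : (n - 1).Coprime n := by
      have : n = (n - 1) + 1 := by omega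
      rw [this]; simp
    have h2 : (n - 1).Coprime 2 := by
      rw [Nat.coprime_two_right, Nat.odd_iff]; omega
    have h4 : (n - 1).Coprime (2 ^ 2) := h2.pow_right 2
    exact Nat.Coprime.mul_right h4 h1
  obtain ⟨P, hgt, hp, hmod⟩ := Nat.forall_exists_prime_gt_and_modEq (4 * n) (by omega) hcop
  obtain ⟨j, hj⟩ : 4 * n ∣ P - (n - 1) := (Nat.modEq_iff_dvd' (by omega)).1 hmod.symm
  have hPn : P + 1 = (4 * j + 1) * n := by
    have : P = 4 * n * j + (n - 1) := by omega
    rw [this]; ring_nf; omega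
  set B := 4 * j + 1 with hB
  have hP4 : P % 4 = 1 := by
    have : (P + 1) % 4 = 2 := by
      rw [hPn, Nat.mul_mod, hn, hB]; omega
    omega
  have hPodd : Odd P := by rw [Nat.odd_iff]; omega
  have hBodd : Odd B := by rw [Nat.odd_iff]; omega
  have : Fact P.Prime := ⟨hp⟩
  have hJ : jacobiSym (-(B : ℤ)) P = 1 := by
    rw [jacobiSym.neg _ hPodd, ZMod.χ₄_nat_one_mod_four hP4, one_mul,
      jacobiSym.quadratic_reciprocity_one_mod_four (by omega) hPodd]
    have : jacobiSym (P : ℤ) B = jacobiSym (-1) B := by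
      apply jacobiSym.mod_left'
      apply Int.ModEq.symm
      rw [Int.modEq_iff_dvd]
      have h3 : (P : ℤ) + 1 = B * n := by exact_mod_cast hPn
      exact ⟨n, by linarith⟩
    rw [this, jacobiSym.at_neg_one hBodd, ZMod.χ₄_nat_one_mod_four (by omega)]
  have hsq := ZMod.isSquare_of_jacobiSym_eq_one hJ
  obtain ⟨y, hy⟩ := hsq
  obtain ⟨Y, rfl⟩ := ZMod.intCast_surjective y
  have hd : (P : ℤ) ∣ Y ^ 2 + B := by
    rw [← ZMod.intCast_zmod_eq_zero_iff_dvd] 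
    push_cast at hy ⊢
    linear_combination -hy
  obtain ⟨A, hA⟩ := hd
  have hB0 : (0 : ℤ) < B := by omega
  have hP0 : (0 : ℤ) < P := by omega
  have hPn' : (P : ℤ) + 1 = B * n := by exact_mod_cast hPn
  have hA0 : 0 < A := by
    by_contra hneg
    have : P * A ≤ 0 := mul_nonpos_of_nonneg_of_nonpos hP0.le (by omega)
    nlinarith [sq_nonneg Y]
  obtain ⟨u, v, w, h⟩ := ternary A.toNat A P n 0 1 Y (by omega) hA0 (by linarith)
    (by linear_combination (-n : ℤ) * hA - hPn') 0 0 1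
  exact ⟨u, v, w, by rw [← h]; ring⟩

lemma sq_mod_four (x : ℤ) : (x % 2 = 0 ∧ x ^ 2 % 4 = 0) ∨ (x % 2 = 1 ∧ x ^ 2 % 8 = 1) := by
  rcases Int.even_or_odd' x with ⟨k, rfl | rfl⟩
  · left; constructor
    · omega
    · ring_nf; omega
  · right; constructor
    · omega
    · have h := Int.even_mul_succ_self k
      obtain ⟨m, hm⟩ := h
      have : (2 * k + 1) ^ 2 = 8 * m + 1 := by linear_combination 4 * hm
      omega

lemma repr_aux (N : ℕ) (p q r : ℤ) (hN : N % 8 = 7) (h : 2 * (N : ℤ) = p ^ 2 + q ^ 2 + r ^ 2)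
    (hp : p % 2 = 1) (hq : q % 2 = 1) (hr : r % 2 = 0) :
    ∃ w v u : ℤ, (N : ℤ) = w ^ 2 + 2 * v ^ 2 + 4 * u ^ 2 := by
  obtain ⟨z, rfl⟩ : ∃ z, r = 2 * z := ⟨r / 2, by omega⟩
  obtain ⟨s, hs⟩ : ∃ s, p + q = 2 * s := ⟨(p + q) / 2, by omega⟩
  obtain rfl : p = 2 * s - q := by linarith
  have h1 : (N : ℤ) = s ^ 2 + (s - q) ^ 2 + 2 * z ^ 2 := by linarith
  rcases Int.even_or_odd' s with ⟨k, hk | hk⟩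
  · exact ⟨s - q, z, k, by rw [h1, hk]; ring⟩
  · obtain ⟨j, hj⟩ : ∃ j, s - q = 2 * j := ⟨(s - q) / 2, by omega⟩
    exact ⟨s, z, j, by rw [h1, hj]; ring⟩

lemma repr_124 (N : ℕ) (hN : N % 8 = 7) :
    ∃ w v u : ℤ, (N : ℤ) = w ^ 2 + 2 * v ^ 2 + 4 * u ^ 2 := by
  obtain ⟨p, q, r, h⟩ := three_squares (2 * N) (by omega)
  push_cast at h
  rcases sq_mod_four p with ⟨hp, hp'⟩ | ⟨hp, hp'⟩ <;> rcases sq_mod_four q with ⟨hq, hq'⟩ | ⟨hq, hq'⟩ <;>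
    rcases sq_mod_four r with ⟨hr, hr'⟩ | ⟨hr, hr'⟩ <;> first
    | omega
    | exact repr_aux N p q r hN h hp hq hr
    | exact repr_aux N p r q hN (by linarith) hp hr hq
    | exact repr_aux N q r p hN (by linarith) hq hr hp

/-- Cauchy-type lemma for the weights 1, 1, 2, 4. -/
lemma cauchy_1124 (a b : ℤ) (ha : a % 2 = 1) (hb : b % 2 = 1) (h1 : b ^ 2 < 8 * a) :
    ∃ x₁ x₂ x₃ x₄ : ℤ, a = x₁ ^ 2 + x₂ ^ 2 + 2 * x₃ ^ 2 + 4 * x₄ ^ 2 ∧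
      b = x₁ + x₂ + 2 * x₃ + 4 * x₄ := by
  obtain ⟨w, v, u, h⟩ := repr_124 (8 * a - b ^ 2).toNat (by
    rcases sq_mod_four b with h | h <;> omega)
  rw [Int.toNat_of_nonneg (by omega)] at h
  have hv : v % 2 = 1 := by
    rcases sq_mod_four b with hb' | hb' <;> rcases sq_mod_four w with hw' | hw' <;>
      rcases sq_mod_four v with hv' | hv' <;> rcases sq_mod_four u with hu' | hu' <;> omega
  have hu : u % 2 = 1 := by
    rcases sq_mod_four b with hb' | hb' <;> rcases sq_mod_four w with hw' | hw' <;>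
      rcases sq_mod_four v with hv' | hv' <;> rcases sq_mod_four u with hu' | hu' <;> omega
  have hw : w % 2 = 1 := by
    rcases sq_mod_four b with hb' | hb' <;> rcases sq_mod_four w with hw' | hw' <;>
      rcases sq_mod_four v with hv' | hv' <;> rcases sq_mod_four u with hu' | hu' <;> omega
  have key : ∃ w', w' ^ 2 = w ^ 2 ∧ (b - w') % 8 = 0 := by
    have hsum : (b ^ 2 + w ^ 2) % 16 = 2 := by
      rcases sq_mod_four v with hv' | hv' <;> rcases sq_mod_four u with hu' | hu' <;> omega
    have hc : ∀ y : ℤ, y % 2 = 1 → (y % 8 = 1 ∨ y % 8 = 7) ∧ y ^ 2 % 16 = 1 ∨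
        (y % 8 = 3 ∨ y % 8 = 5) ∧ y ^ 2 % 16 = 9 := by
      intro y hy
      obtain ⟨k, hk⟩ : ∃ k, y = 8 * k + y % 8 := ⟨y / 8, by omega⟩
      have : y % 8 = 1 ∨ y % 8 = 3 ∨ y % 8 = 5 ∨ y % 8 = 7 := by omega
      rcases this with h | h | h | h <;> rw [h] at hk <;> subst hk <;> ring_nf <;> omega
    rcases hc b hb with hb' | hb' <;> rcases hc w hw with hw' | hw' <;> try omega
    all_goals
      by_cases hh : (b - w) % 8 = 0
      · exact ⟨w, rfl, hh⟩
      · exact ⟨-w, by ring, by omega⟩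
  obtain ⟨w', hw2, hw8⟩ := key
  rw [← hw2] at h
  obtain ⟨x₄, hx4⟩ : ∃ x, b - w' = 8 * x := ⟨(b - w') / 8, by omega⟩
  obtain rfl : w' = b - 8 * x₄ := by linarith
  -- now t = b - 4 x₄
  obtain ⟨v', hv2, hv4⟩ : ∃ v', v' ^ 2 = v ^ 2 ∧ (b - 4 * x₄ - v') % 4 = 0 := by
    by_cases hh : (b - v) % 4 = 0
    · exact ⟨v, rfl, by omega⟩
    · exact ⟨-v, by ring, by omega⟩
  rw [← hv2] at h
  obtain ⟨x₃, hx3⟩ : ∃ x, b - 4 * x₄ - v' = 4 * x := ⟨(b - 4 * x₄ - v') / 4, by omega⟩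
  obtain rfl : v' = b - 4 * x₄ - 4 * x₃ := by linarith
  obtain ⟨x₂, hx2⟩ : ∃ x, b - 4 * x₄ - 2 * x₃ - u = 2 * x :=
    ⟨(b - 4 * x₄ - 2 * x₃ - u) / 2, by omega⟩
  obtain rfl : u = b - 4 * x₄ - 2 * x₃ - 2 * x₂ := by linarith
  refine ⟨b - 4 * x₄ - 2 * x₃ - x₂, x₂, x₃, x₄, ?_, by ring⟩
  nlinarith

lemma cauchy_nonneg (a b : ℤ) (ha : a % 2 = 1) (hb : b % 2 = 1) (hb0 : 0 < b)
    (h1 : b ^ 2 < 8 * a) (h2 : 7 * a < b ^ 2 + 2 * b + 8) :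
    ∃ x₁ x₂ x₃ x₄ : ℕ, a = x₁ ^ 2 + x₂ ^ 2 + 2 * x₃ ^ 2 + 4 * x₄ ^ 2 ∧
      b = x₁ + x₂ + 2 * x₃ + 4 * x₄ := by
  obtain ⟨x₁, x₂, x₃, x₄, e1, e2⟩ := cauchy_1124 a b ha hb h1
  have g1 : 0 ≤ x₁ := by
    by_contra hn
    subst e1 e2
    nlinarith [sq_nonneg (x₂ - x₃), sq_nonneg (x₂ - x₄), sq_nonneg (x₃ - x₄)]
  have g2 : 0 ≤ x₂ := by
    by_contra hn
    subst e1 e2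
    nlinarith [sq_nonneg (x₁ - x₃), sq_nonneg (x₁ - x₄), sq_nonneg (x₃ - x₄)]
  have g3 : 0 ≤ x₃ := by
    by_contra hn
    subst e1 e2
    nlinarith [sq_nonneg (x₁ - x₂), sq_nonneg (x₁ - x₄), sq_nonneg (x₂ - x₄)]
  have g4 : 0 ≤ x₄ := by
    by_contra hn
    subst e1 e2
    nlinarith [sq_nonneg (x₁ - x₂), sq_nonneg (x₁ - x₃), sq_nonneg (x₂ - x₃)]
  lift x₁ to ℕ using g1
  lift x₂ to ℕ using g2
  lift x₃ to ℕ using g3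
  lift x₄ to ℕ using g4
  exact ⟨x₁, x₂, x₃, x₄, e1, e2⟩

lemma pent_int (x : ℕ) : 2 * ((x * (3 * x - 1) / 2 : ℕ) : ℤ) = 3 * x ^ 2 - x := by
  have h : 2 ∣ x * (3 * x - 1) := by
    rcases Nat.even_or_odd' x with ⟨k, rfl | rfl⟩
    · exact ⟨k * (3 * (2 * k) - 1), by ring⟩
    · exact ⟨(2 * k + 1) * (3 * k + 1), by
        have : 3 * (2 * k + 1) - 1 = 2 * (3 * k + 1) := by omega
        rw [this]; ring⟩
  have h2 := Nat.mul_div_cancel' h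
  rcases Nat.eq_zero_or_pos x with rfl | hx
  · simp
  · have h3 : (2 * (x * (3 * x - 1) / 2 : ℕ) : ℤ) = ((x * (3 * x - 1) : ℕ) : ℤ) := by
      exact_mod_cast h2
    rw [h3]
    push_cast [Nat.cast_sub (show 1 ≤ 3 * x by omega)]
    ring

lemma choose_b (n : ℕ) (hn : 1050 ≤ n) : ∃ b : ℤ, b % 2 = 1 ∧ (2 * n + b) % 3 = 0 ∧ 0 < b ∧
    3 * b ^ 2 < 16 * n + 8 * b ∧ 14 * n < 3 * b ^ 2 - b + 24 := by
  obtain ⟨r, hr2, hr3, hr0, hr6⟩ : ∃ r : ℤ, r % 2 = 1 ∧ (2 * n + r) % 3 = 0 ∧ 0 < r ∧ r < 6 := by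
    have : n % 3 = 0 ∨ n % 3 = 1 ∨ n % 3 = 2 := by omega
    rcases this with h | h | h
    · exact ⟨3, by omega, by omega, by omega, by omega⟩
    · exact ⟨1, by omega, by omega, by omega, by omega⟩
    · exact ⟨5, by omega, by omega, by omega, by omega⟩
  have hex : ∃ k : ℕ, 16 * (n : ℤ) + 8 * (6 * k + r) ≤ 3 * (6 * k + r) ^ 2 :=
    ⟨n, by nlinarith⟩
  classical
  have hs := Nat.find_spec hex
  have hmin := fun m => Nat.find_min hex (m := m)
  set k := Nat.find hex
  have hk : k ≠ 0 := by
    intro h0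
    rw [h0] at hs
    push_cast at hs
    nlinarith
  obtain ⟨j, hj⟩ := Nat.exists_eq_succ_of_ne_zero hk
  rw [hj] at hs
  have hf := hmin j (by omega)
  push_cast at hs hf
  set b : ℤ := 6 * j + r with hb
  have hb0 : 0 < b := by omega
  have hs' : 16 * (n : ℤ) + 8 * (b + 6) ≤ 3 * (b + 6) ^ 2 := by
    rw [hb]; linarith
  have hb70 : 70 ≤ b := by
    by_contra hlt
    have : b ≤ 69 := by omega
    nlinarith
  refine ⟨b, by omega, by omega, hb0, by linarith, by nlinarith⟩

/-- Bit mask of the sums `m + c * p₅(x)` with `m` a set bit of `B` and `x` in `L`. -/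
def spread (B c : ℕ) (L : List ℕ) : ℕ :=
  L.foldr (fun x acc => acc ||| (B <<< (c * (x * (3 * x - 1) / 2)))) 0

lemma spread_spec (B c : ℕ) (L : List ℕ) (n : ℕ) (h : (spread B c L).testBit n = true) :
    ∃ x m : ℕ, n = m + c * (x * (3 * x - 1) / 2) ∧ B.testBit m = true := by
  induction L with
  | nil => simp [spread] at h
  | cons x L ih =>
    have e : spread B c (x :: L) = spread B c L ||| (B <<< (c * (x * (3 * x - 1) / 2))) := rfl
    rw [e, Nat.testBit_or, Bool.or_eq_true, Nat.testBit_shiftLeft, Bool.and_eq_true,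
      decide_eq_true_eq] at h
    rcases h with h | ⟨h1, h2⟩
    · exact ih h
    · exact ⟨x, _, by omega, h2⟩

lemma mask_one : spread 1 1 (List.range 28) = 12953744211667879574559723620182851376518044553689702741613315138387691206753180409299070583098010834224349734530787596844063998146251556252683311101125476929068608147837996987569914703726818105084311919130513227229717010240801605971641434391048542510782449661078975576204665284022640448988157160911265115257178597825624150051 := by decide +kernel

lemma mask_two : spread 12953744211667879574559723620182851376518044553689702741613315138387691206753180409299070583098010834224349734530787596844063998146251556252683311101125476929068608147837996987569914703726818105084311919130513227229717010240801605971641434391048542510782449661078975576204665284022640448988157160911265115257178597825624150051 1 (List.range 28) = 167799489101319094866642110962552863153971810859755483182125547076487950594388619099015124386029648179084630276022900791177281972551799350210779187374215311673879772150704242168338367401072857593825912323070701855276393719066487012393413730588958745418747837858609347341780802236774913507912168622576734832467521880302843096895890649985501088836920371218301581834005690189700240030668127592827564689527052998236833758510683652887637720267936855573119240339807781682695653922139161489371852981750294178505600967536992031175004200122911359935840508261526204421163677598488001725795406613712288054154568855412349798988650634409109037334664769522316227687 := by decide +kernel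

lemma mask_three : spread 167799489101319094866642110962552863153971810859755483182125547076487950594388619099015124386029648179084630276022900791177281972551799350210779187374215311673879772150704242168338367401072857593825912323070701855276393719066487012393413730588958745418747837858609347341780802236774913507912168622576734832467521880302843096895890649985501088836920371218301581834005690189700240030668127592827564689527052998236833758510683652887637720267936855573119240339807781682695653922139161489371852981750294178505600967536992031175004200122911359935840508261526204421163677598488001725795406613712288054154568855412349798988650634409109037334664769522316227687 2 (List.range 20) = 33166987009689936355359641164249803938736582686209875883321372915429265065093791834741658002657806159671828645493402457875227906131538660260833361677882663507090154466226850880879589917631350239384987682543985642538751262370577490801281821793767646914542550131283566420843287975182152651452517609549806069949772833017449902466770519434914941628941093408118366699807823113986002176427606038452820384422447959513927953188238809356444709647228110947806993602964848103783816190407722105766124047799982661079721922969740156772444325249504813774215292835524363424804174942704887444813601756508970807406774107825962616797591902535978498662625655610563872780323652233027094591023830615070487706132635023653797638377378158644835134118759871555782557869243475975329544717112155246725695186408123398165105590683247601050142275150924033745125581509109226938742845165201607030727352525677565266351832889928347930250445368362253734899387964242219734213828730618559400345457806918024703 := by decide +kernel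

lemma mask_four : spread 33166987009689936355359641164249803938736582686209875883321372915429265065093791834741658002657806159671828645493402457875227906131538660260833361677882663507090154466226850880879589917631350239384987682543985642538751262370577490801281821793767646914542550131283566420843287975182152651452517609549806069949772833017449902466770519434914941628941093408118366699807823113986002176427606038452820384422447959513927953188238809356444709647228110947806993602964848103783816190407722105766124047799982661079721922969740156772444325249504813774215292835524363424804174942704887444813601756508970807406774107825962616797591902535978498662625655610563872780323652233027094591023830615070487706132635023653797638377378158644835134118759871555782557869243475975329544717112155246725695186408123398165105590683247601050142275150924033745125581509109226938742845165201607030727352525677565266351832889928347930250445368362253734899387964242219734213828730618559400345457806918024703 4 (List.range 14) % 2 ^ 1050 = 2 ^ 1050 - 1 := by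
  decide +kernel

lemma smallCheck_mask :
    spread (spread (spread (spread 1 1 (List.range 28)) 1 (List.range 28))
      2 (List.range 20)) 4 (List.range 14) % 2 ^ 1050 = 2 ^ 1050 - 1 := by
  rw [mask_one, mask_two, mask_three, mask_four]

lemma smallCheck_all (n : ℕ) (hn : n < 1050) :
    (spread (spread (spread (spread 1 1 (List.range 28)) 1 (List.range 28))
      2 (List.range 20)) 4 (List.range 14)).testBit n = true := by
  have h := congrArg (fun m => Nat.testBit m n) smallCheck_mask
  simp only [Nat.testBit_mod_two_pow, Nat.testBit_two_pow_sub_one, hn, decide_true,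
    Bool.true_and] at h
  exact h

theorem sum_pentagonal_1124 (n : ℕ) :
    ∃ x₁ x₂ x₃ x₄ : ℕ,
      n = x₁ * (3 * x₁ - 1) / 2 + x₂ * (3 * x₂ - 1) / 2
          + 2 * (x₃ * (3 * x₃ - 1) / 2) + 4 * (x₄ * (3 * x₄ - 1) / 2) := by
  by_cases hn : n < 1050
  · have h := smallCheck_all n hn
    obtain ⟨x₄, m₄, e₄, h⟩ := spread_spec _ _ _ _ h
    obtain ⟨x₃, m₃, e₃, h⟩ := spread_spec _ _ _ _ h
    obtain ⟨x₂, m₂, e₂, h⟩ := spread_spec _ _ _ _ h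
    obtain ⟨x₁, m₁, e₁, h⟩ := spread_spec _ _ _ _ h
    have h0 : m₁ = 0 := Nat.testBit_one_eq_true_iff_self_eq_zero.1 h
    exact ⟨x₁, x₂, x₃, x₄, by rw [e₄, e₃, e₂, e₁, h0]; ring⟩
  · obtain ⟨b, hb2, hb3, hb0, h1, h2⟩ := choose_b n (by omega)
    obtain ⟨a, ha⟩ : ∃ a, 2 * (n : ℤ) + b = 3 * a := ⟨(2 * n + b) / 3, by omega⟩
    obtain ⟨x₁, x₂, x₃, x₄, e1, e2⟩ := cauchy_nonneg a b (by omega) hb2 hb0 (by linarith)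
      (by linarith)
    refine ⟨x₁, x₂, x₃, x₄, ?_⟩
    zify
    have q1 := pent_int x₁
    have q2 := pent_int x₂
    have q3 := pent_int x₃
    have q4 := pent_int x₄
    push_cast at q1 q2 q3 q4 ⊢
    linarith
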